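/- For all integers n ≥ 0 and k ≥ 2, the map 𝒞 sending a partition P of {1,…,n+1} to the 01-filling of the triangular shape △_n that has a 1 in cell (j−1, i) if and only if (i,j) with i < j is an arc of the arc diagram of P, is a bijection from the set of k-noncrossing partitions of {1,…,n+1} onto the set 𝒞_n^{(k)} of 01-fillings of △_n with at most one 1 in each row, at most one 1 in each column, and no proper SE-chain of length k. -/

import Mathlib

open Finset Polynomial

/-- `(i,j)` with `i < j` is an arc of the arc diagram of `P`: `i` and `j` lie in a common
block `B` and no element of `B` is strictly between them. -/
def IsArc {s : Finset ℕ} (P : Finpartition s) (i j : ℕ) : Prop :=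
  i < j ∧ ∃ B ∈ P.parts, i ∈ B ∧ j ∈ B ∧ ∀ l ∈ B, ¬(i < l ∧ l < j)

/-- `(i,j)` is an arc or a loop (`i = j` and `{i}` a singleton block) of the arc diagram. -/
def IsDiagArc {s : Finset ℕ} (P : Finpartition s) (i j : ℕ) : Prop :=
  IsArc P i j ∨ (i = j ∧ {i} ∈ P.parts)

/-- `P` has a `k`-crossing: arcs `(i₁,j₁),…,(i_k,j_k)` with `i₁<⋯<i_k<j₁<⋯<j_k`. -/
def HasKCrossing {s : Finset ℕ} (P : Finpartition s) (k : ℕ) : Prop :=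
  ∃ f g : Fin k → ℕ,
    StrictMono f ∧ StrictMono g ∧ (∀ m, IsDiagArc P (f m) (g m)) ∧
    ∀ a b : Fin k, f a < g b

/-- `P` has a weak `k`-crossing: arcs `(i₁,j₁),…,(i_k,j_k)` with
`i₁<⋯<i_k = j₁<⋯<j_k` (the largest left endpoint equals the smallest right endpoint). -/
def HasWeakKCrossing {s : Finset ℕ} (P : Finpartition s) (k : ℕ) : Prop :=
  ∃ f g : Fin k → ℕ,
    StrictMono f ∧ StrictMono g ∧ (∀ m, IsDiagArc P (f m) (g m)) ∧
    ∃ a b : Fin k, f a = g b ∧ (∀ c, f c ≤ f a) ∧ (∀ c, g b ≤ g c)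

/-- `P` has an enhanced `k`-crossing: a `k`-crossing or a weak `k`-crossing. -/
def HasEnhancedKCrossing {s : Finset ℕ} (P : Finpartition s) (k : ℕ) : Prop :=
  HasKCrossing P k ∨ HasWeakKCrossing P k

open scoped Classical in
/-- The generating polynomial `∑ t^{number of blocks}` over the partitions of `s`
satisfying the predicate `pr`. -/
noncomputable def partPoly (s : Finset ℕ) (pr : Finpartition s → Prop) : Polynomial ℤ :=
  ∑ P : Finpartition s, if pr P then (X : Polynomial ℤ) ^ P.parts.card else 0


/-- The triangular shape `△_n`: cells `(r,c)` with `1 ≤ c ≤ r ≤ n`. -/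
def triangle (n : ℕ) : Finset (ℕ × ℕ) :=
  (Finset.Icc 1 n ×ˢ Finset.Icc 1 n).filter (fun p => p.2 ≤ p.1)

/-- A set of cells (the positions of the `1`s of a `01`-filling) has at most one `1`
in each row and at most one `1` in each column. -/
def RowColAtMostOne (F : Finset (ℕ × ℕ)) : Prop :=
  (∀ p ∈ F, ∀ q ∈ F, p.1 = q.1 → p = q) ∧ ∀ p ∈ F, ∀ q ∈ F, p.2 = q.2 → p = q

/-- `F` has a proper SE-chain of length `k`: cells `(r₁,c₁),…,(r_k,c_k)` filled with `1`,
`r₁<⋯<r_k`, `c₁<⋯<c_k`, and `c_k ≤ r₁`. -/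
def HasProperSEChain (F : Finset (ℕ × ℕ)) (k : ℕ) : Prop :=
  ∃ f : Fin k → ℕ × ℕ, (∀ m, f m ∈ F) ∧ StrictMono (fun m => (f m).1) ∧
    StrictMono (fun m => (f m).2) ∧ ∀ a b : Fin k, (f b).2 ≤ (f a).1

open scoped Classical in
/-- The map `𝒞`: the filling of `△_n` with a `1` in cell `(j-1,i)` iff `(i,j)`, `i<j`,
is an arc of the arc diagram of `P` (cell `(r,c)` gets a `1` iff `(c,r+1)` is an arc). -/
noncomputable def CMap (n : ℕ) (P : Finpartition (Finset.Icc 1 (n + 1))) :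
    Finset (ℕ × ℕ) :=
  (triangle n).filter (fun rc => IsArc P rc.2 (rc.1 + 1))

theorem IsArc.mem_left {s : Finset ℕ} {P : Finpartition s} {i j : ℕ} (h : IsArc P i j) :
    i ∈ s := by
  obtain ⟨_, B, hB, hi, _, _⟩ := h
  exact P.le hB hi

theorem IsArc.mem_right {s : Finset ℕ} {P : Finpartition s} {i j : ℕ} (h : IsArc P i j) :
    j ∈ s := by
  obtain ⟨_, B, hB, _, hj, _⟩ := h
  exact P.le hB hj

theorem IsArc.right_unique {s : Finset ℕ} {P : Finpartition s} {i j j' : ℕ}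
    (h : IsArc P i j) (h' : IsArc P i j') : j = j' := by
  obtain ⟨hlt, B, hB, hi, hj, hl⟩ := h
  obtain ⟨hlt', B', hB', hi', hj', hl'⟩ := h'
  obtain rfl := P.eq_of_mem_parts hB hB' hi hi'
  have h1 := hl _ hj'
  have h2 := hl' _ hj
  omega

theorem IsArc.left_unique {s : Finset ℕ} {P : Finpartition s} {i i' j : ℕ}
    (h : IsArc P i j) (h' : IsArc P i' j) : i = i' := by
  obtain ⟨hlt, B, hB, hi, hj, hl⟩ := h
  obtain ⟨hlt', B', hB', hi', hj', hl'⟩ := h'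
  obtain rfl := P.eq_of_mem_parts hB hB' hj hj'
  have h1 := hl _ hi'
  have h2 := hl' _ hi
  omega

theorem reflTransGen_isArc_of_mem {s : Finset ℕ} {P : Finpartition s} {B : Finset ℕ}
    (hB : B ∈ P.parts) {x y : ℕ} (hx : x ∈ B) (hy : y ∈ B) (hxy : x ≤ y) :
    Relation.ReflTransGen (IsArc P) x y := by
  induction y using Nat.strong_induction_on with
  | _ y ih =>
    obtain rfl | hlt := hxy.eq_or_lt
    · exact .refl
    have hne : (B.filter (· < y)).Nonempty := ⟨x, by simp [hx, hlt]⟩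
    obtain ⟨m, hm, hmax⟩ := (B.filter (· < y)).exists_max_image id hne
    simp only [Finset.mem_filter, id] at hm hmax
    refine (ih m hm.2 hm.1 (hmax x ⟨hx, hlt⟩)).tail
      ⟨hm.2, B, hB, hm.1, hy, fun l hl h => ?_⟩
    have := hmax l ⟨hl, h.2⟩
    omega

theorem mem_part_of_reflTransGen_isArc {s : Finset ℕ} {P : Finpartition s} {x y : ℕ}
    (hx : x ∈ s) (h : Relation.ReflTransGen (IsArc P) x y) : y ∈ P.part x := by
  induction h with
  | refl => exact P.mem_part hx
  | tail _ hbc ih =>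
    obtain ⟨_, B, hB, hb, hc, _⟩ := hbc
    rwa [P.eq_of_mem_parts (P.part_mem.2 hx) hB ih hb]

theorem part_subset_part_of_isArc {s : Finset ℕ} {P Q : Finpartition s}
    (h : ∀ i j, IsArc P i j → IsArc Q i j) (x : ℕ) : P.part x ⊆ Q.part x := by
  intro y hy
  obtain ⟨B, hB, hyB, hxB⟩ := P.mem_part_iff_exists.1 hy
  obtain hle | hle := le_total x y
  · exact mem_part_of_reflTransGen_isArc (P.le hB hxB)
      (Relation.ReflTransGen.mono h _ _ (reflTransGen_isArc_of_mem hB hxB hyB hle))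
  · have := mem_part_of_reflTransGen_isArc (P.le hB hyB)
      (Relation.ReflTransGen.mono h _ _ (reflTransGen_isArc_of_mem hB hyB hxB hle))
    rw [Q.mem_part_iff_exists] at this ⊢
    obtain ⟨C, hC, h1, h2⟩ := this
    exact ⟨C, hC, h2, h1⟩

/-- A partition is determined by its arcs. -/
theorem Finpartition.ext_isArc {s : Finset ℕ} {P Q : Finpartition s}
    (h : ∀ i j, IsArc P i j ↔ IsArc Q i j) : P = Q := by
  have hpart (x : ℕ) : P.part x = Q.part x :=
    (part_subset_part_of_isArc (fun i j => (h i j).1) x).antisymm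
      (part_subset_part_of_isArc (fun i j => (h i j).2) x)
  ext B
  constructor
  · intro hB
    obtain ⟨x, hx⟩ := P.nonempty_of_mem_parts hB
    rw [← P.part_eq_of_mem hB hx, hpart]
    exact Q.part_mem.2 (P.le hB hx)
  · intro hB
    obtain ⟨x, hx⟩ := Q.nonempty_of_mem_parts hB
    rw [← Q.part_eq_of_mem hB hx, ← hpart]
    exact P.part_mem.2 (Q.le hB hx)

/-- Any increasing relation on `s` in which every element has at most one successor and at most
one predecessor is the arc relation of a partition of `s`. -/
theorem exists_finpartition_isArc_iff (s : Finset ℕ) (r : ℕ → ℕ → Prop)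
    (hs : ∀ i j, r i j → i ∈ s ∧ j ∈ s) (hlt : ∀ i j, r i j → i < j)
    (hright : ∀ i j j', r i j → r i j' → j = j')
    (hleft : ∀ i i' j, r i j → r i' j → i = i') :
    ∃ P : Finpartition s, ∀ i j, IsArc P i j ↔ r i j := by
  classical
  have hle : ∀ {i j}, Relation.ReflTransGen r i j → i ≤ j := by
    intro i j h
    induction h with
    | refl => exact le_rfl
    | tail _ h ih => exact ih.trans (hlt _ _ h).le
  have hru : Relator.RightUnique r := fun i j j' h h' => hright i j j' h h'
  have hlu : Relator.RightUnique (Function.swap r) := fun j i i' h h' => hleft i i' j h h'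
  let S : Setoid ℕ :=
    { r := fun x y => Relation.ReflTransGen r x y ∨ Relation.ReflTransGen r y x
      iseqv :=
        { refl := fun x => .inl .refl
          symm := fun h => h.symm
          trans := by
            rintro x y z (h | h) (h' | h')
            · exact .inl (h.trans h')
            · have := Relation.ReflTransGen.total_of_right_unique hlu h.swap h'.swap
              exact this.symm.imp (fun t => Relation.reflTransGen_swap.1 t)
                (fun t => Relation.reflTransGen_swap.1 t)
            · exact Relation.ReflTransGen.total_of_right_unique hru h h'
            · exact .inr (h'.trans h) } }
  have hS (x y : ℕ) : S x y ↔ Relation.ReflTransGen r x y ∨ Relation.ReflTransGen r y x := Iff.rfl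
  let P := Finpartition.ofSetSetoid S s
  have hP (a b : ℕ) : b ∈ P.part a ↔ a ∈ s ∧ b ∈ s ∧ S a b :=
    Finpartition.mem_part_ofSetSetoid_iff_rel s
  refine ⟨P, fun i j => ⟨?_, fun h => ?_⟩⟩
  · rintro ⟨hij, B, hB, hi, hj, hl⟩
    obtain rfl := P.part_eq_of_mem hB hi
    have hj' := ((hP i j).1 hj).2.2
    rw [hS] at hj'
    have hch := hj'.resolve_right fun h => by have := hle h; omega
    obtain rfl | ⟨m, him, hmj⟩ := hch.cases_head
    · omega
    have hm : m ∈ P.part i := (hP i m).2 ⟨(hs _ _ him).1, (hs _ _ him).2, .inl (.single him)⟩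
    have h1 := hlt _ _ him
    have h2 := hle hmj
    have h3 := hl m hm
    obtain rfl : m = j := by omega
    exact him
  · obtain ⟨hi, hj⟩ := hs _ _ h
    refine ⟨hlt _ _ h, P.part i, P.part_mem.2 hi, P.mem_part hi,
      (hP i j).2 ⟨hi, hj, .inl (.single h)⟩, fun l hl hl' => ?_⟩
    have hil := ((hP i l).1 hl).2.2
    rw [hS] at hil
    have hch := hil.resolve_right fun h => by have := hle h; omega
    obtain rfl | ⟨m, him, hml⟩ := hch.cases_head
    · omega
    obtain rfl := hright _ _ _ h him
    have := hle hml
    omega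

theorem mem_triangle {n : ℕ} {p : ℕ × ℕ} : p ∈ triangle n ↔ 1 ≤ p.2 ∧ p.2 ≤ p.1 ∧ p.1 ≤ n := by
  simp only [triangle, Finset.mem_filter, Finset.mem_product, Finset.mem_Icc]
  omega

theorem mem_CMap {n : ℕ} {P : Finpartition (Finset.Icc 1 (n + 1))} {p : ℕ × ℕ} :
    p ∈ CMap n P ↔ IsArc P p.2 (p.1 + 1) := by
  simp only [CMap, Finset.mem_filter, and_iff_right_iff_imp, mem_triangle]
  intro h
  have h1 := Finset.mem_Icc.1 h.mem_left
  have h2 := Finset.mem_Icc.1 h.mem_right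
  have h3 := h.1
  omega

theorem rowColAtMostOne_CMap (n : ℕ) (P : Finpartition (Finset.Icc 1 (n + 1))) :
    RowColAtMostOne (CMap n P) := by
  constructor
  · intro p hp q hq h
    rw [mem_CMap] at hp hq
    rw [← h] at hq
    exact Prod.ext h (hp.left_unique hq)
  · intro p hp q hq h
    rw [mem_CMap] at hp hq
    rw [← h] at hq
    exact Prod.ext (Nat.succ_injective (hp.right_unique hq)) h

/-- Proper SE-chains of the filling correspond to crossings of the partition. -/
theorem hasProperSEChain_CMap_iff {n k : ℕ} {P : Finpartition (Finset.Icc 1 (n + 1))} :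
    HasProperSEChain (CMap n P) k ↔ HasKCrossing P k := by
  constructor
  · rintro ⟨f, hf, h1, h2, h3⟩
    refine ⟨fun m => (f m).2, fun m => (f m).1 + 1, h2, h1.add_const 1,
      fun m => .inl (mem_CMap.1 (hf m)), fun a b => Nat.lt_succ_of_le (h3 b a)⟩
  · rintro ⟨f, g, hf, hg, harc, hlt⟩
    have hpos (m : Fin k) : g m - 1 + 1 = g m := by have := hlt m m; omega
    refine ⟨fun m => (g m - 1, f m), fun m => ?_, fun a b hab => ?_, hf, fun a b => ?_⟩
    · rw [mem_CMap]
      simp only [hpos]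
      exact (harc m).resolve_right fun h => (hlt m m).ne h.1
    · have := hg hab
      have := hpos a
      have := hpos b
      dsimp only
      omega
    · have := hlt b a
      dsimp only
      omega

theorem CMap_injective (n : ℕ) : Function.Injective (CMap n) := by
  intro P Q h
  refine Finpartition.ext_isArc fun i j => ?_
  cases j with
  | zero => exact iff_of_false (fun h => Nat.not_lt_zero _ h.1) (fun h => Nat.not_lt_zero _ h.1)
  | succ j => rw [← mem_CMap (p := (j, i)), h, mem_CMap]

theorem exists_CMap_eq {n : ℕ} {F : Finset (ℕ × ℕ)} (hF : F ⊆ triangle n)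
    (hF' : RowColAtMostOne F) : ∃ P, CMap n P = F := by
  obtain ⟨P, hP⟩ : ∃ P : Finpartition (Finset.Icc 1 (n + 1)),
      ∀ i j, IsArc P i j ↔ ∃ r, j = r + 1 ∧ (r, i) ∈ F := by
    apply exists_finpartition_isArc_iff
    · rintro i _ ⟨r, rfl, h⟩
      have := mem_triangle.1 (hF h)
      simp only [Finset.mem_Icc]
      omega
    · rintro i _ ⟨r, rfl, h⟩
      have := mem_triangle.1 (hF h)
      omega
    · rintro i _ _ ⟨r, rfl, h⟩ ⟨r', rfl, h'⟩
      have := hF'.2 _ h _ h' rfl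
      simp_all
    · rintro i i' _ ⟨r, rfl, h⟩ ⟨r', hr, h'⟩
      have := hF'.1 _ h _ h' (Nat.succ_injective hr)
      simp_all
  refine ⟨P, ?_⟩
  ext p
  simp [mem_CMap, hP]

/-- For `n ≥ 0`, `k ≥ 2`, the map `𝒞` is a bijection from the
`k`-noncrossing partitions of `{1,…,n+1}` onto the set `𝒞_n^{(k)}` of `01`-fillings of
`△_n` with at most one `1` per row and per column and no proper SE-chain of length `k`. -/
theorem stmt7 (n k : ℕ) (hk : 2 ≤ k) :
    Set.BijOn (CMap n)
      {P : Finpartition (Finset.Icc 1 (n + 1)) | ¬ HasKCrossing P k}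
      {F : Finset (ℕ × ℕ) |
        F ⊆ triangle n ∧ RowColAtMostOne F ∧ ¬ HasProperSEChain F k} := by
  refine ⟨fun P hP => ⟨by classical exact Finset.filter_subset _ _, rowColAtMostOne_CMap n P,
    mt hasProperSEChain_CMap_iff.1 hP⟩, (CMap_injective n).injOn, ?_⟩
  rintro F ⟨hF, hF', hchain⟩
  obtain ⟨P, rfl⟩ := exists_CMap_eq hF hF'
  exact ⟨P, mt hasProperSEChain_CMap_iff.2 hchain, rfl⟩
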